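/- For every integer r ≥ 2 there exists a constant C > 0 such that for all n ≥ 3, all α, β > 0 with a = 1/α and b = 1/β, and all 1 ≤ j_1 < ⋯ < j_r ≤ n−2 for which j_{l+1} ≤ j_l + 2 holds for at least one l ∈ {1, …, r−1}, the probability under ℙ_{n,α,β} that, for every l = 1, …, r, the box (n−j_l−1, j_l) contains α is at most C/(n+a+b)^r. -/

import Mathlib

open scoped BigOperators

/-- A symbol in an α/β-staircase tableau: empty, α, or β. -/
inductive StairSymb : Type
  | empty : StairSymb
  | alpha : StairSymb
  | beta  : StairSymb
  deriving DecidableEq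

/-- `S` is an α/β-staircase tableau of size `n` (1-based indexing; boxes are the
pairs `(i,j)` with `1 ≤ i`, `1 ≤ j`, `i + j ≤ n + 1`; outside the boxes `S` is empty). -/
def IsStaircase (n : ℕ) (S : ℕ → ℕ → StairSymb) : Prop :=
  (∀ i j, ¬(1 ≤ i ∧ 1 ≤ j ∧ i + j ≤ n + 1) → S i j = StairSymb.empty) ∧
  (∀ i i' j, 1 ≤ i → i < i' → 1 ≤ j → i' + j ≤ n + 1 →
    S i' j = StairSymb.alpha → S i j = StairSymb.empty) ∧
  (∀ i j j', 1 ≤ i → 1 ≤ j → j < j' → i + j' ≤ n + 1 →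
    S i j' = StairSymb.beta → S i j = StairSymb.empty) ∧
  (∀ i j, 1 ≤ i → 1 ≤ j → i + j = n + 1 → S i j ≠ StairSymb.empty)

/-- The weight `wt(S) = α^{N_α(S)} β^{N_β(S)}` of a tableau. -/
noncomputable def stairWt (α β : ℝ) (S : ℕ → ℕ → StairSymb) : ℝ :=
  α ^ Set.ncard {p : ℕ × ℕ | S p.1 p.2 = StairSymb.alpha} *
  β ^ Set.ncard {p : ℕ × ℕ | S p.1 p.2 = StairSymb.beta}

/-- The partition function `Z_n(α,β)`, the total weight of all tableaux of size `n`. -/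
noncomputable def stairZ (n : ℕ) (α β : ℝ) : ℝ :=
  ∑ᶠ S ∈ {S : ℕ → ℕ → StairSymb | IsStaircase n S}, stairWt α β S

/-- The probability `ℙ_{n,α,β}(E)` of an event `E` (a set of tableaux of size `n`). -/
noncomputable def stairP (n : ℕ) (α β : ℝ) (E : (ℕ → ℕ → StairSymb) → Prop) : ℝ :=
  (∑ᶠ S ∈ {S : ℕ → ℕ → StairSymb | IsStaircase n S ∧ E S}, stairWt α β S) / stairZ n α β

/-- The expectation `E_{n,α,β}[f]` of a real function of the random tableau. -/
noncomputable def stairE (n : ℕ) (α β : ℝ) (f : (ℕ → ℕ → StairSymb) → ℝ) : ℝ :=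
  (∑ᶠ S ∈ {S : ℕ → ℕ → StairSymb | IsStaircase n S}, f S * stairWt α β S) / stairZ n α β

section Columns

open StairSymb Finset
open scoped Classical

/-- Columns supported on the rows of `F` that are at most `i`, with nothing above an `α`. -/
noncomputable def partialCols : ℕ → Finset ℕ → Finset (ℕ → StairSymb)
  | 0, _ => {fun _ => empty}
  | i + 1, F =>
    if i + 1 ∈ F then
      partialCols i F ∪
        ((partialCols i F).image (fun c => Function.update c (i + 1) beta) ∪
          {Function.update (fun _ => empty) (i + 1) alpha})
    else partialCols i F

theorem mem_partialCols {i : ℕ} {F : Finset ℕ} {c : ℕ → StairSymb} :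
    c ∈ partialCols i F ↔
      (∀ k, c k ≠ empty → 1 ≤ k ∧ k ≤ i ∧ k ∈ F) ∧
      (∀ k k', k < k' → c k' = alpha → c k = empty) := by
  induction i generalizing c with
  | zero =>
    simp only [partialCols, mem_singleton]
    constructor
    · rintro rfl
      simp
    · rintro ⟨h, -⟩
      funext k
      by_contra hk
      have := h k hk
      omega
  | succ i ih =>
    rw [partialCols]
    split_ifs with hi
    · simp only [mem_union, mem_image, mem_singleton]
      constructor
      · rintro (h | ⟨c, h, rfl⟩ | rfl)
        · rw [ih] at h
          exact ⟨fun k hk => ⟨(h.1 k hk).1, by have := (h.1 k hk).2.1; omega, (h.1 k hk).2.2⟩, h.2⟩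
        · rw [ih] at h
          refine ⟨fun k hk => ?_, fun k k' hkk hk' => ?_⟩
          · by_cases hki : k = i + 1
            · subst hki
              exact ⟨by omega, le_rfl, hi⟩
            · rw [Function.update_of_ne hki] at hk
              exact ⟨(h.1 k hk).1, by have := (h.1 k hk).2.1; omega, (h.1 k hk).2.2⟩
          · by_cases hki' : k' = i + 1
            · subst hki'
              simp at hk'
            · rw [Function.update_of_ne hki'] at hk'
              have h1 := h.1 k' (by rw [hk']; simp)
              rw [Function.update_of_ne (by omega)]
              exact h.2 k k' hkk hk'
        · refine ⟨fun k hk => ?_, fun k k' hkk hk' => ?_⟩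
          · by_cases hki : k = i + 1
            · subst hki
              exact ⟨by omega, le_rfl, hi⟩
            · rw [Function.update_of_ne hki] at hk
              simp at hk
          · by_cases hki' : k' = i + 1
            · rw [Function.update_of_ne (by omega)]
            · rw [Function.update_of_ne hki'] at hk'
              simp at hk'
      · rintro ⟨h1, h2⟩
        rcases hc : c (i + 1) with _ | _ | _
        · left
          rw [ih]
          refine ⟨fun k hk => ?_, h2⟩
          have := h1 k hk
          have hne : k ≠ i + 1 := by
            rintro rfl
            exact hk hc
          exact ⟨this.1, by omega, this.2.2⟩
        · right; right
          funext k
          by_cases hki : k = i + 1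
          · subst hki
            simp [hc]
          · rw [Function.update_of_ne hki]
            by_contra hk
            have := h1 k hk
            exact hk (h2 k (i + 1) (by omega) hc)
        · right; left
          refine ⟨Function.update c (i + 1) empty, ?_, ?_⟩
          · rw [ih]
            refine ⟨fun k hk => ?_, fun k k' hkk hk' => ?_⟩
            · by_cases hki : k = i + 1
              · subst hki
                simp at hk
              · rw [Function.update_of_ne hki] at hk
                have := h1 k hk
                exact ⟨this.1, by omega, this.2.2⟩
            · by_cases hki' : k' = i + 1
              · subst hki'
                simp at hk'
              · rw [Function.update_of_ne hki'] at hk'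
                by_cases hki : k = i + 1
                · subst hki
                  simp
                · rw [Function.update_of_ne hki]
                  exact h2 k k' hkk hk'
          · rw [Function.update_idem, ← hc, Function.update_eq_self]
    · rw [ih]
      constructor
      · rintro ⟨h1, h2⟩
        exact ⟨fun k hk => ⟨(h1 k hk).1, by have := (h1 k hk).2.1; omega, (h1 k hk).2.2⟩, h2⟩
      · rintro ⟨h1, h2⟩
        refine ⟨fun k hk => ?_, h2⟩
        have := h1 k hk
        have hne : k ≠ i + 1 := by
          rintro rfl
          exact hi this.2.2
        exact ⟨this.1, by omega, this.2.2⟩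

theorem eq_empty_of_mem_partialCols {i k : ℕ} {F : Finset ℕ} {c : ℕ → StairSymb}
    (hc : c ∈ partialCols i F) (hk : i < k) : c k = empty := by
  by_contra h
  have := (mem_partialCols.1 hc).1 k h
  omega

theorem update_beta_injOn (i : ℕ) (F : Finset ℕ) :
    Set.InjOn (fun c : ℕ → StairSymb => Function.update c (i + 1) beta) (partialCols i F) := by
  intro c hc d hd h
  have hc' := eq_empty_of_mem_partialCols hc (Nat.lt_succ_self i)
  have hd' := eq_empty_of_mem_partialCols hd (Nat.lt_succ_self i)
  funext k
  by_cases hk : k = i + 1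
  · subst hk
    exact hc'.trans hd'.symm
  · simpa [Function.update_of_ne hk] using congrFun h k

theorem sum_partialCols_succ_of_mem {i : ℕ} {F : Finset ℕ} (hi : i + 1 ∈ F)
    (f : (ℕ → StairSymb) → ℝ) :
    ∑ c ∈ partialCols (i + 1) F, f c =
      ∑ c ∈ partialCols i F, f c +
        (∑ c ∈ partialCols i F, f (Function.update c (i + 1) beta) +
          f (Function.update (fun _ => empty) (i + 1) alpha)) := by
  rw [partialCols, if_pos hi, sum_union, sum_union, sum_singleton,
    sum_image (update_beta_injOn i F)]
  · rw [disjoint_singleton_right, mem_image]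
    rintro ⟨c, -, h⟩
    simpa using congrFun h (i + 1)
  · rw [disjoint_left]
    intro c hc h
    have := eq_empty_of_mem_partialCols hc (Nat.lt_succ_self i)
    rw [mem_union, mem_image, mem_singleton] at h
    rcases h with ⟨d, -, rfl⟩ | rfl <;> simp at this

theorem partialCols_succ_of_notMem {i : ℕ} {F : Finset ℕ} (hi : i + 1 ∉ F) :
    partialCols (i + 1) F = partialCols i F := by
  rw [partialCols, if_neg hi]

/-- Columns of length `n + 1` whose symbols above the diagonal box lie in the rows of `F`. -/
noncomputable def fullCols (n : ℕ) (F : Finset ℕ) : Finset (ℕ → StairSymb) :=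
  insert (Function.update (fun _ => empty) (n + 1) alpha)
    ((partialCols n F).image (fun c => Function.update c (n + 1) beta))

theorem sum_fullCols (n : ℕ) (F : Finset ℕ) (f : (ℕ → StairSymb) → ℝ) :
    ∑ c ∈ fullCols n F, f c =
      f (Function.update (fun _ => empty) (n + 1) alpha) +
        ∑ c ∈ partialCols n F, f (Function.update c (n + 1) beta) := by
  rw [fullCols, sum_insert, sum_image (update_beta_injOn n F)]
  rw [mem_image]
  rintro ⟨c, -, h⟩
  simpa using congrFun h (n + 1)

theorem mem_fullCols {n : ℕ} {F : Finset ℕ} {c : ℕ → StairSymb} :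
    c ∈ fullCols n F ↔
      (∀ k, c k ≠ empty → 1 ≤ k ∧ (k = n + 1 ∨ k ≤ n ∧ k ∈ F)) ∧
      (∀ k k', k < k' → c k' = alpha → c k = empty) ∧ c (n + 1) ≠ empty := by
  have key : c ∈ fullCols n F ↔
      c ∈ partialCols (n + 1) (insert (n + 1) (F.filter (· ≤ n))) ∧ c (n + 1) ≠ empty := by
    have hF : ∀ c, c ∈ partialCols n (insert (n + 1) (F.filter (· ≤ n))) ↔
        c ∈ partialCols n F := by
      intro c
      simp only [mem_partialCols, mem_insert, mem_filter]
      refine and_congr_left fun _ => forall_congr' fun k => imp_congr_right fun _ => ?_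
      constructor
      · rintro ⟨h1, h2, h3 | h3⟩
        · omega
        · exact ⟨h1, h2, h3.1⟩
      · rintro ⟨h1, h2, h3⟩
        exact ⟨h1, h2, Or.inr ⟨h3, h2⟩⟩
    rw [fullCols, partialCols, if_pos (mem_insert_self _ _)]
    simp only [mem_insert, mem_union, mem_image, mem_singleton, hF]
    constructor
    · rintro (rfl | ⟨d, hd, rfl⟩)
      · exact ⟨Or.inr (Or.inr rfl), by simp⟩
      · exact ⟨Or.inr (Or.inl ⟨d, hd, rfl⟩), by simp⟩
    · rintro ⟨h | h | h, hne⟩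
      · exact absurd (eq_empty_of_mem_partialCols h (Nat.lt_succ_self n)) hne
      · exact Or.inr h
      · exact Or.inl h
  rw [key, mem_partialCols, and_assoc]
  refine and_congr_left fun _ => forall_congr' fun k => imp_congr_right fun _ => ?_
  simp only [mem_insert, mem_filter]
  constructor
  · rintro ⟨h1, h2, h3 | h3⟩
    · exact ⟨h1, Or.inl h3⟩
    · exact ⟨h1, Or.inr ⟨h3.2, h3.1⟩⟩
  · rintro ⟨h1, h3 | h3⟩
    · exact ⟨h1, h3.le, Or.inl h3⟩
    · exact ⟨h1, by omega, Or.inr ⟨h3.2, h3.1⟩⟩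

/-- The weight of a column. -/
noncomputable def colWt (α β : ℝ) (c : ℕ → StairSymb) : ℝ :=
  α ^ Set.ncard {i | c i = alpha} * β ^ Set.ncard {i | c i = beta}

theorem colWt_single_alpha (α β : ℝ) (i : ℕ) :
    colWt α β (Function.update (fun _ => empty) i alpha) = α := by
  have h1 : {k | Function.update (fun _ => empty) i alpha k = alpha} = {i} := by
    ext k
    by_cases hk : k = i <;> simp [Function.update_apply, hk]
  have h2 : {k | Function.update (fun _ => empty) i alpha k = beta} = ∅ := by
    ext k
    by_cases hk : k = i <;> simp [Function.update_apply, hk]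
  rw [colWt, h1, h2]
  simp

theorem colWt_update_beta (α β : ℝ) {i k : ℕ} {F : Finset ℕ} {c : ℕ → StairSymb}
    (hc : c ∈ partialCols i F) (hk : i < k) :
    colWt α β (Function.update c k beta) = β * colWt α β c := by
  have hck := eq_empty_of_mem_partialCols hc hk
  have h1 : {l | Function.update c k beta l = alpha} = {l | c l = alpha} := by
    ext l
    by_cases hl : l = k
    · subst hl
      simp [hck]
    · simp [hl]
  have h2 : {l | Function.update c k beta l = beta} = insert k {l | c l = beta} := by
    ext l
    by_cases hl : l = k <;> simp [hl]
  have hfin : {l | c l = beta}.Finite := by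
    refine (Set.finite_Iic i).subset fun l (hl : c l = beta) => ?_
    exact ((mem_partialCols.1 hc).1 l (by simp [hl])).2.1
  rw [colWt, colWt, h1, h2, Set.ncard_insert_of_notMem (by simp [hck]) hfin]
  ring

end Columns

section Tableaux

open StairSymb Finset
open scoped Classical

/-- The filling obtained by putting the column `c` to the left of the filling `S`. -/
def addCol (c : ℕ → StairSymb) (S : ℕ → ℕ → StairSymb) : ℕ → ℕ → StairSymb
  | _, 0 => empty
  | i, 1 => c i
  | i, j + 2 => S i (j + 1)

/-- The filling obtained by deleting the first column of `S`. -/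
def dropCol (S : ℕ → ℕ → StairSymb) : ℕ → ℕ → StairSymb
  | _, 0 => empty
  | i, j + 1 => S i (j + 2)

/-- The rows of `S` among the first `n` which contain no `β`. -/
noncomputable def freeRows (n : ℕ) (S : ℕ → ℕ → StairSymb) : Finset ℕ :=
  (Icc 1 n).filter (fun i => ∀ j, S i j ≠ beta)

theorem addCol_succ (c : ℕ → StairSymb) (S : ℕ → ℕ → StairSymb) (i : ℕ) {j : ℕ} (hj : 1 ≤ j) :
    addCol c S i (j + 1) = S i j := by
  obtain ⟨j, rfl⟩ := Nat.exists_eq_add_of_le' hj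
  rfl

theorem IsStaircase.eq_empty_left {n : ℕ} {S : ℕ → ℕ → StairSymb} (h : IsStaircase n S) {i : ℕ}
    (hi : ∃ j, S i (j + 2) = beta) : S i 1 = empty := by
  obtain ⟨j, hj⟩ := hi
  by_cases hb : 1 ≤ i ∧ 1 ≤ j + 2 ∧ i + (j + 2) ≤ n + 1
  · exact h.2.2.1 i 1 (j + 2) hb.1 le_rfl (by omega) hb.2.2 hj
  · rw [h.1 i (j + 2) hb] at hj
    cases hj

theorem isStaircase_addCol {n : ℕ} {S : ℕ → ℕ → StairSymb} (h : IsStaircase n S)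
    {c : ℕ → StairSymb} (hc : c ∈ fullCols n (freeRows n S)) :
    IsStaircase (n + 1) (addCol c S) := by
  rw [mem_fullCols] at hc
  obtain ⟨h1, h2, h3, h4⟩ := h
  obtain ⟨c1, c2, c3⟩ := hc
  refine ⟨?_, ?_, ?_, ?_⟩
  · intro i j hij
    match j with
    | 0 => rfl
    | 1 =>
      change c i = empty
      by_contra hne
      have := c1 i hne
      omega
    | j + 2 => exact h1 i (j + 1) (by omega)
  · intro i i' j hi hii hj hij hα
    match j with
    | 0 => rfl
    | 1 => exact c2 i i' hii hα
    | j + 2 => exact h2 i i' (j + 1) hi hii (by omega) (by omega) hα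
  · intro i j j' hi hj hjj hij hβ
    match j, j' with
    | 0, _ => rfl
    | 1, 0 => omega
    | 1, 1 => omega
    | 1, j' + 2 =>
      change c i = empty
      change S i (j' + 1) = beta at hβ
      by_contra hne
      have := c1 i hne
      rcases this.2 with h | h
      · omega
      · rw [freeRows, mem_filter] at h
        exact h.2.2 _ hβ
    | j + 2, 0 => omega
    | j + 2, 1 => omega
    | j + 2, j' + 2 => exact h3 i (j + 1) (j' + 1) hi (by omega) (by omega) (by omega) hβ
  · intro i j hi hj hij
    match j with
    | 0 => omega
    | 1 =>
      obtain rfl : i = n + 1 := by omega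
      exact c3
    | j + 2 => exact h4 i (j + 1) hi (by omega) (by omega)

theorem isStaircase_dropCol {n : ℕ} {S : ℕ → ℕ → StairSymb} (h : IsStaircase (n + 1) S) :
    IsStaircase n (dropCol S) := by
  obtain ⟨h1, h2, h3, h4⟩ := h
  refine ⟨?_, ?_, ?_, ?_⟩
  · intro i j hij
    match j with
    | 0 => rfl
    | j + 1 => exact h1 i (j + 2) (by omega)
  · intro i i' j hi hii hj hij hα
    match j with
    | 0 => rfl
    | j + 1 => exact h2 i i' (j + 2) hi hii (by omega) (by omega) hα
  · intro i j j' hi hj hjj hij hβ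
    match j, j' with
    | 0, _ => rfl
    | j + 1, 0 => omega
    | j + 1, j' + 1 => exact h3 i (j + 2) (j' + 2) hi (by omega) (by omega) (by omega) hβ
  · intro i j hi hj hij
    match j with
    | 0 => omega
    | j + 1 => exact h4 i (j + 2) hi (by omega) (by omega)

theorem firstCol_mem_fullCols {n : ℕ} {S : ℕ → ℕ → StairSymb} (h : IsStaircase (n + 1) S) :
    (fun i => S i 1) ∈ fullCols n (freeRows n (dropCol S)) := by
  rw [mem_fullCols]
  have hbox : ∀ i j, S i j ≠ empty → 1 ≤ i ∧ 1 ≤ j ∧ i + j ≤ n + 1 + 1 := by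
    intro i j hne
    by_contra hb
    exact hne (h.1 i j hb)
  refine ⟨fun k hk => ?_, fun k k' hkk hk' => ?_, ?_⟩
  · have hk1 := hbox k 1 hk
    refine ⟨hk1.1, ?_⟩
    by_cases hkn : k = n + 1
    · exact Or.inl hkn
    · refine Or.inr ⟨by omega, ?_⟩
      rw [freeRows, mem_filter, mem_Icc]
      refine ⟨by omega, fun j hj => ?_⟩
      match j with
      | 0 => cases hj
      | j + 1 => exact hk (h.eq_empty_left ⟨j, hj⟩)
  · by_contra hne
    have hk := hbox k 1 hne
    have hk1 := hbox k' 1 (by rw [hk']; simp)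
    exact hne (h.2.1 k k' 1 hk.1 hkk le_rfl (by omega) hk')
  · exact h.2.2.2 (n + 1) 1 (by omega) le_rfl rfl

theorem addCol_dropCol {n : ℕ} {S : ℕ → ℕ → StairSymb} (h : IsStaircase n S) :
    addCol (fun i => S i 1) (dropCol S) = S := by
  funext i j
  match j with
  | 0 => exact (h.1 i 0 (by omega)).symm
  | 1 => rfl
  | j + 2 => rfl

theorem IsStaircase.addCol_inj {n n' : ℕ} {S S' : ℕ → ℕ → StairSymb} (h : IsStaircase n S)
    (h' : IsStaircase n' S') {c c' : ℕ → StairSymb} (heq : addCol c S = addCol c' S') :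
    S = S' ∧ c = c' := by
  constructor
  · funext i j
    match j with
    | 0 => rw [h.1 i 0 (by omega), h'.1 i 0 (by omega)]
    | j + 1 => exact congrFun (congrFun heq i) (j + 2)
  · funext i
    exact congrFun (congrFun heq i) 1

/-- The staircase tableaux of size `n` such that each column of length `m ∈ M` has an `α` in the
third box from the bottom. -/
noncomputable def thirdDiagTableaux (M : Finset ℕ) : ℕ → Finset (ℕ → ℕ → StairSymb)
  | 0 => {fun _ _ => empty}
  | n + 1 =>
    ((thirdDiagTableaux M n).sigma (fun S =>
      (fullCols n (freeRows n S)).filter (fun c => n + 1 ∈ M → c (n - 1) = alpha))).image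
        (fun p => addCol p.2 p.1)

theorem mem_thirdDiagTableaux {M : Finset ℕ} {n : ℕ} {S : ℕ → ℕ → StairSymb} :
    S ∈ thirdDiagTableaux M n ↔
      IsStaircase n S ∧ ∀ m ∈ M, 1 ≤ m → m ≤ n → S (m - 2) (n + 1 - m) = alpha := by
  induction n generalizing S with
  | zero =>
    rw [thirdDiagTableaux, mem_singleton]
    constructor
    · rintro rfl
      refine ⟨⟨fun _ _ _ => rfl, fun _ _ _ _ _ _ _ _ => rfl, fun _ _ _ _ _ _ _ _ => rfl,
        fun _ _ _ _ _ => by omega⟩, fun _ _ _ _ => by omega⟩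
    · rintro ⟨h, -⟩
      funext i j
      exact h.1 i j (by omega)
  | succ n ih =>
    simp only [thirdDiagTableaux, mem_image, mem_sigma, mem_filter, Sigma.exists, ih]
    constructor
    · rintro ⟨S, c, ⟨⟨hS, hM⟩, hc, hcM⟩, rfl⟩
      refine ⟨isStaircase_addCol hS hc, fun m hm hm1 hmn => ?_⟩
      rcases Nat.lt_or_ge n m with h | h
      · obtain rfl : m = n + 1 := by omega
        have e : n + 1 + 1 - (n + 1) = 1 := by omega
        rw [e]
        exact hcM hm
      · have e : n + 1 + 1 - m = (n + 1 - m) + 1 := by omega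
        rw [e, addCol_succ _ _ _ (by omega)]
        exact hM m hm hm1 h
    · rintro ⟨h, hM⟩
      refine ⟨dropCol S, fun i => S i 1, ⟨⟨isStaircase_dropCol h, fun m hm hm1 hmn => ?_⟩,
        firstCol_mem_fullCols h, fun hn => ?_⟩, addCol_dropCol h⟩
      · have := hM m hm hm1 (by omega)
        have e : n + 1 + 1 - m = (n - m) + 2 := by omega
        have e' : n + 1 - m = (n - m) + 1 := by omega
        rw [e] at this
        rw [e']
        exact this
      · have := hM (n + 1) hn (by omega) le_rfl
        have e : n + 1 + 1 - (n + 1) = 1 := by omega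
        rw [e] at this
        exact this

theorem freeRows_addCol {n : ℕ} {S : ℕ → ℕ → StairSymb} (h : IsStaircase n S)
    (c : ℕ → StairSymb) :
    freeRows (n + 1) (addCol c S) =
      (insert (n + 1) (freeRows n S)).filter (fun i => c i ≠ beta) := by
  ext i
  simp only [freeRows, mem_filter, mem_insert, mem_Icc]
  have key : (∀ j, addCol c S i j ≠ beta) ↔ (∀ j, S i j ≠ beta) ∧ c i ≠ beta := by
    constructor
    · intro H
      refine ⟨fun j => ?_, H 1⟩
      match j with
      | 0 =>
        rw [h.1 i 0 (by omega)]
        simp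
      | j + 1 => exact H (j + 2)
    · rintro ⟨H1, H2⟩ j
      match j with
      | 0 => simp [addCol]
      | 1 => exact H2
      | j + 2 => exact H1 (j + 1)
  rw [key]
  constructor
  · rintro ⟨hi, H1, H2⟩
    refine ⟨?_, H2⟩
    by_cases hin : i = n + 1
    · exact Or.inl hin
    · exact Or.inr ⟨by omega, H1⟩
  · rintro ⟨rfl | hi, H2⟩
    · refine ⟨by omega, fun j => ?_, H2⟩
      rw [h.1 (n + 1) j (by omega)]
      simp
    · exact ⟨by omega, hi.2, H2⟩

theorem IsStaircase.finite_symb {n : ℕ} {S : ℕ → ℕ → StairSymb} (h : IsStaircase n S)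
    {x : StairSymb} (hx : x ≠ empty) : {p : ℕ × ℕ | S p.1 p.2 = x}.Finite := by
  refine ((Set.finite_Iic (n + 1)).prod (Set.finite_Iic (n + 1))).subset ?_
  rintro ⟨i, j⟩ (hp : S i j = x)
  by_contra hb
  rw [Set.mem_prod, Set.mem_Iic, Set.mem_Iic] at hb
  exact hx (hp.symm.trans (h.1 i j (by omega)))

theorem ncard_addCol {n : ℕ} {S : ℕ → ℕ → StairSymb} (h : IsStaircase n S)
    {c : ℕ → StairSymb} {F : Finset ℕ} (hc : c ∈ fullCols n F) {x : StairSymb}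
    (hx : x ≠ empty) :
    Set.ncard {p : ℕ × ℕ | addCol c S p.1 p.2 = x} =
      Set.ncard {i | c i = x} + Set.ncard {p : ℕ × ℕ | S p.1 p.2 = x} := by
  have hsplit : {p : ℕ × ℕ | addCol c S p.1 p.2 = x} =
      (fun i => (i, 1)) '' {i | c i = x} ∪
        (fun p : ℕ × ℕ => (p.1, p.2 + 1)) '' {p : ℕ × ℕ | S p.1 p.2 = x} := by
    ext ⟨i, j⟩
    simp only [Set.mem_ofPred_eq, Set.mem_union, Set.mem_image, Prod.mk.injEq, Prod.exists]
    match j with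
    | 0 => simp [addCol, hx.symm]
    | 1 =>
      have : S i 0 ≠ x := by
        rw [h.1 i 0 (by omega)]
        exact hx.symm
      simp [addCol, this]
    | j + 2 => simp [addCol]
  have hcf : {i | c i = x}.Finite := by
    refine (Set.finite_Iic (n + 1)).subset fun i (hi : c i = x) => ?_
    have := (mem_fullCols.1 hc).1 i (by rwa [hi])
    rw [Set.mem_Iic]
    omega
  rw [hsplit, Set.ncard_union_eq ?_ (hcf.image _) ((h.finite_symb hx).image _),
    Set.ncard_image_of_injective, Set.ncard_image_of_injective]
  · rintro ⟨i, j⟩ ⟨i', j'⟩ hp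
    simpa using hp
  · intro i i' hi
    simpa using hi
  · rw [Set.disjoint_left]
    rintro ⟨i, j⟩ ⟨i', hi', h1⟩ ⟨⟨i'', j''⟩, hp, h2⟩
    simp only [Prod.mk.injEq] at h1 h2
    obtain rfl : j'' = 0 := by omega
    simp only [Set.mem_ofPred_eq] at hp
    exact hx (hp.symm.trans (h.1 i'' 0 (by omega)))

theorem stairWt_addCol {n : ℕ} {S : ℕ → ℕ → StairSymb} (h : IsStaircase n S)
    {c : ℕ → StairSymb} {F : Finset ℕ} (hc : c ∈ fullCols n F) (α β : ℝ) :
    stairWt α β (addCol c S) = stairWt α β S * colWt α β c := by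
  rw [stairWt, stairWt, colWt, ncard_addCol h hc (by simp), ncard_addCol h hc (by simp),
    pow_add, pow_add]
  ring

/-- The weighted sum of a statistic of the set of free rows over `thirdDiagTableaux M n`. -/
noncomputable def freeSum (α β : ℝ) (M : Finset ℕ) (n : ℕ) (φ : Finset ℕ → ℝ) : ℝ :=
  ∑ S ∈ thirdDiagTableaux M n, stairWt α β S * φ (freeRows n S)

/-- The effect of adding a column of length `n + 1` on statistics of the set of free rows. -/
noncomputable def colOp (α β : ℝ) (M : Finset ℕ) (n : ℕ) (φ : Finset ℕ → ℝ) (F : Finset ℕ) : ℝ :=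
  ∑ c ∈ (fullCols n F).filter (fun c => n + 1 ∈ M → c (n - 1) = alpha),
    colWt α β c * φ ((insert (n + 1) F).filter (fun i => c i ≠ beta))

theorem freeSum_succ (α β : ℝ) (M : Finset ℕ) (n : ℕ) (φ : Finset ℕ → ℝ) :
    freeSum α β M (n + 1) φ = freeSum α β M n (colOp α β M n φ) := by
  rw [freeSum, thirdDiagTableaux, sum_image, sum_sigma, freeSum]
  · refine sum_congr rfl fun S hS => ?_
    rw [colOp, mul_sum]
    refine sum_congr rfl fun c hc => ?_
    have hS' := (mem_thirdDiagTableaux.1 hS).1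
    rw [stairWt_addCol hS' (mem_filter.1 hc).1, freeRows_addCol hS', mul_assoc]
  · rintro ⟨S, c⟩ hp ⟨S', c'⟩ hp' heq
    rw [mem_coe, mem_sigma] at hp hp'
    obtain ⟨rfl, rfl⟩ := (mem_thirdDiagTableaux.1 hp.1).1.addCol_inj
      (mem_thirdDiagTableaux.1 hp'.1).1 heq
    rfl

theorem freeSum_zero (α β : ℝ) (M : Finset ℕ) (φ : Finset ℕ → ℝ) :
    freeSum α β M 0 φ = φ ∅ := by
  simp [freeSum, thirdDiagTableaux, freeRows, stairWt]

theorem freeRows_subset (n : ℕ) (S : ℕ → ℕ → StairSymb) : freeRows n S ⊆ Icc 1 n :=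
  filter_subset _ _

theorem freeSum_congr (α β : ℝ) (M : Finset ℕ) (n : ℕ) {φ ψ : Finset ℕ → ℝ}
    (h : ∀ F ⊆ Icc 1 n, φ F = ψ F) : freeSum α β M n φ = freeSum α β M n ψ :=
  sum_congr rfl fun S _ => by rw [h _ (freeRows_subset n S)]

theorem freeSum_mul (α β : ℝ) (M : Finset ℕ) (n : ℕ) (x : ℝ) (φ : Finset ℕ → ℝ) :
    freeSum α β M n (fun F => x * φ F) = x * freeSum α β M n φ := by
  rw [freeSum, freeSum, mul_sum]
  exact sum_congr rfl fun S _ => by ring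

theorem freeSum_add (α β : ℝ) (M : Finset ℕ) (n : ℕ) (φ ψ : Finset ℕ → ℝ) :
    freeSum α β M n (fun F => φ F + ψ F) = freeSum α β M n φ + freeSum α β M n ψ := by
  rw [freeSum, freeSum, freeSum, ← sum_add_distrib]
  exact sum_congr rfl fun S _ => by ring

end Tableaux

section ColumnOperators

open StairSymb Finset
open scoped Classical

/-- The weighted sum of a statistic of the remaining free rows over `partialCols i F`. -/
noncomputable def partSum (α β : ℝ) (i : ℕ) (φ : Finset ℕ → ℝ) (F : Finset ℕ) : ℝ :=
  ∑ c ∈ partialCols i F, colWt α β c * φ (F.filter (fun k => c k ≠ beta))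

theorem partSum_zero (α β : ℝ) (φ : Finset ℕ → ℝ) (F : Finset ℕ) :
    partSum α β 0 φ F = φ F := by
  simp [partSum, partialCols, colWt]

theorem partSum_succ_of_notMem (α β : ℝ) (φ : Finset ℕ → ℝ) {i : ℕ} {F : Finset ℕ}
    (hi : i + 1 ∉ F) : partSum α β (i + 1) φ F = partSum α β i φ F := by
  rw [partSum, partialCols_succ_of_notMem hi, partSum]

theorem partialCols_erase (i : ℕ) (F : Finset ℕ) :
    partialCols i (F.erase (i + 1)) = partialCols i F := by
  ext c
  rw [mem_partialCols, mem_partialCols]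
  refine and_congr_left fun _ => forall_congr' fun k => imp_congr_right fun _ => ?_
  rw [mem_erase]
  constructor
  · rintro ⟨h1, h2, h3⟩
    exact ⟨h1, h2, h3.2⟩
  · rintro ⟨h1, h2, h3⟩
    exact ⟨h1, h2, by omega, h3⟩

theorem filter_update_beta (c : ℕ → StairSymb) (k : ℕ) (F : Finset ℕ) :
    F.filter (fun l => Function.update c k beta l ≠ beta) =
      (F.erase k).filter (fun l => c l ≠ beta) := by
  ext l
  by_cases hl : l = k <;> simp [hl]

theorem filter_single_alpha (k : ℕ) (F : Finset ℕ) :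
    F.filter (fun l => Function.update (fun _ => empty) k alpha l ≠ beta) = F := by
  refine filter_true_of_mem fun l _ => ?_
  by_cases hl : l = k <;> simp [hl]

theorem partSum_succ_of_mem (α β : ℝ) (φ : Finset ℕ → ℝ) {i : ℕ} {F : Finset ℕ}
    (hi : i + 1 ∈ F) :
    partSum α β (i + 1) φ F =
      partSum α β i φ F + β * partSum α β i φ (F.erase (i + 1)) + α * φ F := by
  rw [partSum, sum_partialCols_succ_of_mem hi, colWt_single_alpha, filter_single_alpha, partSum,
    partSum, partialCols_erase, mul_sum, add_assoc]
  congr 2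
  refine sum_congr rfl fun c hc => ?_
  rw [colWt_update_beta α β hc (Nat.lt_succ_self i), filter_update_beta, mul_assoc]

theorem partSum_ite_mem (α β : ℝ) (φ : Finset ℕ → ℝ) {i t : ℕ} (ht : i < t) (F : Finset ℕ) :
    partSum α β i (fun G => if t ∈ G then φ G else 0) F =
      if t ∈ F then partSum α β i φ F else 0 := by
  have key : ∀ c ∈ partialCols i F, (t ∈ F.filter (fun k => c k ≠ beta) ↔ t ∈ F) := by
    intro c hc
    rw [mem_filter, eq_empty_of_mem_partialCols hc ht]
    simp
  unfold partSum
  split_ifs with h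
  · exact sum_congr rfl fun c hc => by simp only [if_pos ((key c hc).2 h)]
  · exact sum_eq_zero fun c hc => by simp only [if_neg (mt (key c hc).1 h), mul_zero]

theorem partSum_pow_card (α β z : ℝ) (i : ℕ) (F : Finset ℕ) (hF : ∀ k ∈ F, 1 ≤ k) :
    β * partSum α β i (fun G => z ^ G.card) F =
      z ^ (F.filter (fun k => i < k)).card *
        ((α * z + β) * (z + β) ^ (F.filter (fun k => k ≤ i)).card -
          α * z * z ^ (F.filter (fun k => k ≤ i)).card) := by
  induction i generalizing F with
  | zero =>
    have h1 : F.filter (fun k => 0 < k) = F := filter_true_of_mem fun k hk => hF k hk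
    have h2 : F.filter (fun k => k ≤ 0) = ∅ :=
      filter_false_of_mem fun k hk => by have := hF k hk; omega
    rw [partSum_zero, h1, h2, card_empty]
    ring
  | succ i ih =>
    by_cases hi : i + 1 ∈ F
    · have hlow : F.filter (fun k => k ≤ i + 1) = insert (i + 1) (F.filter (fun k => k ≤ i)) := by
        ext k
        simp only [mem_filter, mem_insert]
        constructor
        · rintro ⟨h1, h2⟩
          by_cases hk : k = i + 1
          · exact Or.inl hk
          · exact Or.inr ⟨h1, by omega⟩
        · rintro (rfl | h)
          · exact ⟨hi, le_rfl⟩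
          · exact ⟨h.1, by omega⟩
      have hhigh : F.filter (fun k => i < k) =
          insert (i + 1) (F.filter (fun k => i + 1 < k)) := by
        ext k
        simp only [mem_filter, mem_insert]
        constructor
        · rintro ⟨h1, h2⟩
          by_cases hk : k = i + 1
          · exact Or.inl hk
          · exact Or.inr ⟨h1, by omega⟩
        · rintro (rfl | h)
          · exact ⟨hi, by omega⟩
          · exact ⟨h.1, by omega⟩
      have elow : (F.erase (i + 1)).filter (fun k => k ≤ i) = F.filter (fun k => k ≤ i) := by
        ext k
        simp only [mem_filter, mem_erase]
        constructor
        · rintro ⟨h1, h2⟩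
          exact ⟨h1.2, h2⟩
        · rintro ⟨h1, h2⟩
          exact ⟨⟨by omega, h1⟩, h2⟩
      have ehigh : (F.erase (i + 1)).filter (fun k => i < k) =
          F.filter (fun k => i + 1 < k) := by
        ext k
        simp only [mem_filter, mem_erase]
        constructor
        · rintro ⟨h1, h2⟩
          exact ⟨h1.2, by omega⟩
        · rintro ⟨h1, h2⟩
          exact ⟨⟨by omega, h1⟩, by omega⟩
      have hcard : F.card = (F.filter (fun k => i + 1 < k)).card +
          ((F.filter (fun k => k ≤ i)).card + 1) := by
        rw [← card_filter_add_card_filter_not (fun k => i + 1 < k)]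
        simp only [not_lt]
        rw [hlow, card_insert_of_notMem (by simp)]
      rw [partSum_succ_of_mem α β _ hi, mul_add, mul_add, ih F hF, ih (F.erase (i + 1))
        (fun k hk => hF k (mem_of_mem_erase hk)), hhigh, elow, ehigh, hlow, hcard,
        card_insert_of_notMem (by simp), card_insert_of_notMem (by simp)]
      ring
    · have hlow : F.filter (fun k => k ≤ i + 1) = F.filter (fun k => k ≤ i) := by
        refine filter_congr fun k hk => ?_
        have : k ≠ i + 1 := fun h => hi (h ▸ hk)
        omega
      have hhigh : F.filter (fun k => i + 1 < k) = F.filter (fun k => i < k) := by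
        refine filter_congr fun k hk => ?_
        have : k ≠ i + 1 := fun h => hi (h ▸ hk)
        omega
      rw [partSum_succ_of_notMem α β _ hi, ih F hF, hlow, hhigh]

theorem partSum_pow_card_of_subset (α β z : ℝ) {i : ℕ} {F : Finset ℕ} (hF : F ⊆ Icc 1 i) :
    β * partSum α β i (fun G => z ^ G.card) F =
      (α * z + β) * (z + β) ^ F.card - α * z * z ^ F.card := by
  have h1 : F.filter (fun k => k ≤ i) = F :=
    filter_true_of_mem fun k hk => (mem_Icc.1 (hF hk)).2
  have h2 : F.filter (fun k => i < k) = ∅ :=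
    filter_false_of_mem fun k hk => not_lt.2 (mem_Icc.1 (hF hk)).2
  rw [partSum_pow_card α β z i F (fun k hk => (mem_Icc.1 (hF hk)).1), h1, h2, card_empty,
    pow_zero, one_mul]

theorem succ_notMem_of_subset {n : ℕ} {F : Finset ℕ} (hF : F ⊆ Icc 1 n) : n + 1 ∉ F :=
  fun h => by
    have := mem_Icc.1 (hF h)
    omega

theorem colOp_of_notMem (α β : ℝ) {M : Finset ℕ} {n : ℕ} (hn : n + 1 ∉ M)
    (φ : Finset ℕ → ℝ) {F : Finset ℕ} (hF : F ⊆ Icc 1 n) :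
    colOp α β M n φ F = α * φ (insert (n + 1) F) + β * partSum α β n φ F := by
  rw [colOp, filter_true_of_mem (fun _ _ h => absurd h hn), sum_fullCols, colWt_single_alpha,
    filter_single_alpha, partSum, mul_sum]
  congr 1
  refine sum_congr rfl fun c hc => ?_
  rw [colWt_update_beta α β hc (Nat.lt_succ_self n), filter_update_beta,
    erase_insert (succ_notMem_of_subset hF), mul_assoc]

theorem sum_partialCols_ite_alpha (t : ℕ) (F : Finset ℕ) (f : (ℕ → StairSymb) → ℝ) :
    ∑ c ∈ partialCols (t + 1) F, (if c (t + 1) = alpha then f c else 0) =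
      if t + 1 ∈ F then f (Function.update (fun _ => empty) (t + 1) alpha) else 0 := by
  have h0 : ∑ c ∈ partialCols t F, (if c (t + 1) = alpha then f c else 0) = 0 :=
    sum_eq_zero fun c hc => by
      rw [eq_empty_of_mem_partialCols hc (Nat.lt_succ_self t), if_neg (by simp)]
  split_ifs with h
  · rw [sum_partialCols_succ_of_mem h, h0]
    simp
  · rw [partialCols_succ_of_notMem h, h0]

theorem colOp_of_mem (α β : ℝ) {M : Finset ℕ} {t : ℕ} (hn : t + 3 ∈ M)
    (φ : Finset ℕ → ℝ) {F : Finset ℕ} (hF : F ⊆ Icc 1 (t + 2)) :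
    colOp α β M (t + 2) φ F =
      if t + 1 ∈ F then
        α * β * (φ F + if t + 2 ∈ F then β * φ (F.erase (t + 2)) else 0) else 0 := by
  have e : t + 2 - 1 = t + 1 := rfl
  have hn' : t + 2 + 1 ∈ M := hn
  have hF' : t + 3 ∉ F := succ_notMem_of_subset hF
  have hstep : colOp α β M (t + 2) φ F =
      ∑ c ∈ partialCols (t + 2) F, (if c (t + 1) = alpha then
        β * colWt α β c * φ (F.filter (fun k => c k ≠ beta)) else 0) := by
    rw [colOp, sum_filter, sum_fullCols]
    simp only [hn', true_imp_iff, e]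
    rw [if_neg, zero_add]
    · refine sum_congr rfl fun c hc => ?_
      rw [colWt_update_beta α β hc (Nat.lt_succ_self _), filter_update_beta,
        erase_insert hF', Function.update_of_ne (by omega)]
    · rw [Function.update_of_ne (by omega)]
      simp
  rw [hstep]
  by_cases h2 : t + 2 ∈ F
  · rw [sum_partialCols_succ_of_mem h2]
    have hlast : Function.update (fun _ => empty) (t + 1 + 1) alpha (t + 1) ≠ alpha := by
      rw [Function.update_of_ne (by omega)]
      simp
    rw [if_neg hlast, add_zero, sum_partialCols_ite_alpha]
    have hup : ∑ c ∈ partialCols (t + 1) F,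
        (if Function.update c (t + 1 + 1) beta (t + 1) = alpha then
          β * colWt α β (Function.update c (t + 1 + 1) beta) *
            φ (F.filter (fun k => Function.update c (t + 1 + 1) beta k ≠ beta)) else 0) =
        ∑ c ∈ partialCols (t + 1) F, (if c (t + 1) = alpha then
          β * (β * colWt α β c) *
            φ ((F.erase (t + 2)).filter (fun k => c k ≠ beta)) else 0) := by
      refine sum_congr rfl fun c hc => ?_
      rw [colWt_update_beta α β hc (Nat.lt_succ_self _), filter_update_beta,
        Function.update_of_ne (by omega)]
    rw [hup, sum_partialCols_ite_alpha, colWt_single_alpha, filter_single_alpha,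
      filter_single_alpha, if_pos h2]
    split_ifs <;> ring
  · rw [partialCols_succ_of_notMem h2, sum_partialCols_ite_alpha, colWt_single_alpha,
      filter_single_alpha, if_neg h2]
    split_ifs <;> ring

theorem colOp_pow_card (α β z : ℝ) {M : Finset ℕ} {n : ℕ} (hn : n + 1 ∉ M)
    {F : Finset ℕ} (hF : F ⊆ Icc 1 n) :
    colOp α β M n (fun G => z ^ G.card) F = (α * z + β) * (z + β) ^ F.card := by
  rw [colOp_of_notMem α β hn _ hF, partSum_pow_card_of_subset α β z hF,
    card_insert_of_notMem (succ_notMem_of_subset hF)]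
  ring

theorem freeSum_succ_pow_card (α β z : ℝ) {M : Finset ℕ} {n : ℕ} (hn : n + 1 ∉ M) :
    freeSum α β M (n + 1) (fun G => z ^ G.card) =
      (α * z + β) * freeSum α β M n (fun G => (z + β) ^ G.card) := by
  rw [freeSum_succ, freeSum_congr α β M n (fun F hF => colOp_pow_card α β z hn hF),
    freeSum_mul]

theorem freeSum_succ_ite_mem (α β : ℝ) {M : Finset ℕ} (hM : ∀ m ∈ M, 3 ≤ m) (n : ℕ)
    (φ : Finset ℕ → ℝ) :
    freeSum α β M (n + 1) (fun G => if n + 1 ∈ G then φ G else 0) =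
      if n + 1 ∈ M then 0 else α * freeSum α β M n (fun F => φ (insert (n + 1) F)) := by
  rw [freeSum_succ]
  split_ifs with hn
  · obtain ⟨t, rfl⟩ : ∃ t, n = t + 2 := ⟨n - 2, by have := hM _ hn; omega⟩
    have h0 : freeSum α β M (t + 2) (fun _ => 0 * 0) = 0 := by
      rw [freeSum_mul, zero_mul]
    refine (freeSum_congr α β M _ fun F hF => ?_).trans h0
    rw [colOp_of_mem α β hn _ hF, if_neg (succ_notMem_of_subset hF),
      if_neg (fun h => succ_notMem_of_subset hF (mem_of_mem_erase h))]
    simp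
  · rw [← freeSum_mul]
    refine freeSum_congr α β M _ fun F hF => ?_
    rw [colOp_of_notMem α β hn _ hF, partSum_ite_mem α β φ (Nat.lt_succ_self n),
      if_neg (succ_notMem_of_subset hF), if_pos (mem_insert_self _ _), mul_zero, add_zero]

end ColumnOperators

section Bounds

open StairSymb Finset
open scoped Classical

theorem partSum_congr (α β : ℝ) (i : ℕ) {φ ψ : Finset ℕ → ℝ} {F : Finset ℕ}
    (h : ∀ G ⊆ F, φ G = ψ G) : partSum α β i φ F = partSum α β i ψ F :=
  sum_congr rfl fun c _ => by rw [h _ (filter_subset _ _)]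

theorem partSum_mul (α β : ℝ) (i : ℕ) (x : ℝ) (φ : Finset ℕ → ℝ) (F : Finset ℕ) :
    partSum α β i (fun G => x * φ G) F = x * partSum α β i φ F := by
  rw [partSum, partSum, mul_sum]
  exact sum_congr rfl fun _ _ => by ring

theorem partSum_const_zero (α β : ℝ) (i : ℕ) (F : Finset ℕ) :
    partSum α β i (fun _ => 0) F = 0 :=
  sum_eq_zero fun _ _ => mul_zero _

theorem partSum_pow_card_insert (α β z : ℝ) {m : ℕ} {F : Finset ℕ} (hF : F ⊆ Icc 1 m) :
    β * partSum α β m (fun G => z ^ G.card) (insert (m + 1) F) =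
      z * ((α * z + β) * (z + β) ^ F.card - α * z * z ^ F.card) := by
  have h1 : (insert (m + 1) F).filter (fun k => k ≤ m) = F := by
    rw [filter_insert, if_neg (by omega)]
    exact filter_true_of_mem fun k hk => (mem_Icc.1 (hF hk)).2
  have h2 : (insert (m + 1) F).filter (fun k => m < k) = {m + 1} := by
    rw [filter_insert, if_pos (by omega),
      filter_false_of_mem fun k hk => not_lt.2 (mem_Icc.1 (hF hk)).2]
    rfl
  rw [partSum_pow_card, h1, h2, card_singleton, pow_one]
  intro k hk
  rcases mem_insert.1 hk with rfl | hk
  · omega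
  · exact (mem_Icc.1 (hF hk)).1

/-- Adding three columns, the last one having an `α` on the third diagonal. -/
theorem freeSum_add_three (α β z : ℝ) {M : Finset ℕ} (hM : ∀ m ∈ M, 3 ≤ m) {m : ℕ}
    (h3 : m + 3 ∈ M) (h2 : m + 2 ∉ M) :
    freeSum α β M (m + 3) (fun G => z ^ G.card) =
      if m + 1 ∈ M then 0 else
        α ^ 2 * β * z * (2 * (α * β) * freeSum α β M m (fun G => z ^ G.card) +
          (α * z + β) * freeSum α β M m (fun G => (z + β) ^ G.card)) := by
  have step : ∀ F ⊆ Icc 1 (m + 1),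
      colOp α β M (m + 1) (colOp α β M (m + 2) (fun G => z ^ G.card)) F =
        if m + 1 ∈ F then
          α * (α * β * (z ^ (F.card + 1) + β * z ^ F.card)) +
            β * (α * β * partSum α β m (fun G => z ^ G.card) F + α * (α * β * z ^ F.card))
        else 0 := by
    intro F hF
    have hF2 : m + 2 ∉ F := succ_notMem_of_subset hF
    have hFs : F ⊆ Icc 1 (m + 2) := hF.trans (Icc_subset_Icc_right (by omega))
    have hins : insert (m + 2) F ⊆ Icc 1 (m + 2) :=
      insert_subset (mem_Icc.2 (by omega)) hFs
    have hpart : partSum α β (m + 1) (colOp α β M (m + 2) (fun G => z ^ G.card)) F =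
        partSum α β (m + 1) (fun G => if m + 1 ∈ G then α * β * z ^ G.card else 0) F := by
      refine partSum_congr α β _ fun G hG => ?_
      rw [colOp_of_mem α β h3 _ (hG.trans hFs), if_neg (fun h => hF2 (hG h)), add_zero]
    rw [colOp_of_notMem α β h2 _ hF, hpart, colOp_of_mem α β h3 _ hins,
      if_pos (mem_insert_self _ _), erase_insert hF2, card_insert_of_notMem hF2]
    have hmem : m + 1 ∈ insert (m + 2) F ↔ m + 1 ∈ F := by
      rw [mem_insert]
      constructor
      · rintro (h | h)
        · omega
        · exact h
      · exact Or.inr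
    by_cases h1 : m + 1 ∈ F
    · rw [if_pos (hmem.2 h1), if_pos h1, partSum_succ_of_mem α β _ h1,
        partSum_ite_mem α β _ (Nat.lt_succ_self m), partSum_ite_mem α β _ (Nat.lt_succ_self m),
        if_pos h1, if_neg (by simp), if_pos h1, partSum_mul, mul_zero, add_zero]
    · rw [if_neg (mt hmem.1 h1), if_neg h1,
        partSum_congr α β _ (fun G hG => if_neg (fun h => h1 (hG h))), partSum_const_zero]
      ring
  rw [freeSum_succ, freeSum_succ, freeSum_congr α β M _ step, freeSum_succ_ite_mem α β hM]
  refine if_congr Iff.rfl rfl ?_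
  have hfin : ∀ F ⊆ Icc 1 m,
      α * (α * β * (z ^ ((insert (m + 1) F).card + 1) + β * z ^ (insert (m + 1) F).card)) +
        β * (α * β * partSum α β m (fun G => z ^ G.card) (insert (m + 1) F) +
          α * (α * β * z ^ (insert (m + 1) F).card)) =
      α * β * z * (2 * (α * β)) * z ^ F.card +
        α * β * z * (α * z + β) * (z + β) ^ F.card := by
    intro F hF
    have := partSum_pow_card_insert α β z hF
    rw [card_insert_of_notMem (succ_notMem_of_subset hF), mul_add β,
      mul_left_comm β (α * β), this]
    ring
  rw [freeSum_congr α β M m hfin, freeSum_add, freeSum_mul, freeSum_mul]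
  ring

/-- Adding four columns, the last two both having an `α` on the third diagonal. -/
theorem freeSum_add_four (α β z : ℝ) {M : Finset ℕ} (hM : ∀ m ∈ M, 3 ≤ m) {m : ℕ}
    (h4 : m + 4 ∈ M) (h3 : m + 3 ∈ M) :
    freeSum α β M (m + 4) (fun G => z ^ G.card) =
      if m + 2 ∈ M then 0 else if m + 1 ∈ M then 0 else
        α ^ 4 * β ^ 2 * z ^ 2 * freeSum α β M m (fun G => z ^ G.card) := by
  have step : ∀ F ⊆ Icc 1 (m + 2),
      colOp α β M (m + 2) (colOp α β M (m + 3) (fun G => z ^ G.card)) F =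
        if m + 2 ∈ F then
          (if m + 1 ∈ F then (α * β) ^ 2 * z ^ F.card else 0)
        else 0 := by
    intro F hF
    have hFs : F ⊆ Icc 1 (m + 1 + 2) := hF.trans (Icc_subset_Icc_right (by omega))
    have hF3 : m + 1 + 2 ∉ F := succ_notMem_of_subset hF
    have hF3' : m + 1 + 2 ∉ F.erase (m + 2) := fun h => hF3 (mem_of_mem_erase h)
    rw [colOp_of_mem α β h3 _ hF, colOp_of_mem α β h4 _ hFs,
      colOp_of_mem α β h4 _ ((erase_subset _ _).trans hFs), if_neg hF3, if_neg hF3',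
      if_neg (notMem_erase (m + 1 + 1) F)]
    simp only [mul_zero, ite_self, add_zero]
    split_ifs <;> ring
  rw [freeSum_succ, freeSum_succ, freeSum_congr α β M _ step, freeSum_succ_ite_mem α β hM]
  refine if_congr Iff.rfl rfl ?_
  have step2 : ∀ F ⊆ Icc 1 (m + 1),
      (if m + 1 ∈ insert (m + 1 + 1) F then
        (α * β) ^ 2 * z ^ (insert (m + 1 + 1) F).card else 0) =
      if m + 1 ∈ F then (α * β) ^ 2 * z ^ (F.card + 1) else 0 := by
    intro F hF
    rw [card_insert_of_notMem (succ_notMem_of_subset hF)]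
    refine if_congr ?_ rfl rfl
    rw [mem_insert]
    constructor
    · rintro (h | h)
      · omega
      · exact h
    · exact Or.inr
  rw [freeSum_congr α β M _ step2, freeSum_succ_ite_mem α β hM, mul_ite, mul_zero]
  refine if_congr Iff.rfl rfl ?_
  have step3 : ∀ F ⊆ Icc 1 m, (α * β) ^ 2 * z ^ ((insert (m + 1) F).card + 1) =
      (α * β) ^ 2 * z ^ 2 * z ^ F.card := by
    intro F hF
    rw [card_insert_of_notMem (succ_notMem_of_subset hF)]
    ring
  rw [freeSum_congr α β M _ step3, freeSum_mul]
  ring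

theorem freeSum_empty_pow_card {α β : ℝ} (hα : 0 < α) (n : ℕ) (y : ℝ) :
    freeSum α β ∅ n (fun G => (β * y) ^ G.card) =
      (α * β) ^ n * ∏ i ∈ range n, (y + 1 / α + i) := by
  induction n generalizing y with
  | zero => simp [freeSum_zero]
  | succ n ih =>
    have e : β * y + β = β * (y + 1) := by ring
    have e' : α * (β * y) + β = α * β * (y + 1 / α) := by
      field_simp
    rw [freeSum_succ_pow_card α β _ (notMem_empty _), e, e', ih, prod_range_succ', pow_succ]
    have : ∏ i ∈ range n, (y + 1 + 1 / α + (i : ℝ)) =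
        ∏ i ∈ range n, (y + 1 / α + ((i + 1 : ℕ) : ℝ)) :=
      prod_congr rfl fun i _ => by push_cast; ring
    rw [this]
    push_cast
    ring

/-- The constants in the bound for `freeSum`. -/
noncomputable def freeSumConst : ℕ → ℝ
  | 0 => 1
  | s + 1 => 9 * 5 ^ s * freeSumConst s

theorem freeSumConst_pos (s : ℕ) : 0 < freeSumConst s := by
  induction s with
  | zero => exact one_pos
  | succ s ih =>
    rw [freeSumConst]
    positivity

theorem inv_pow_le_of_le_five_mul {s : ℕ} {x x' : ℝ} (hx : 0 < x) (hx' : 0 < x')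
    (h : s = 0 ∨ x' ≤ 5 * x) : 1 / x ^ s ≤ 5 ^ s / x' ^ s := by
  rw [div_le_div_iff₀ (by positivity) (by positivity), one_mul, ← mul_pow]
  rcases h with rfl | h
  · simp
  · exact pow_le_pow_left₀ hx'.le h s

theorem single_step_bound {s : ℕ} {x y : ℝ} (hyx : y ≤ x) (hx : 0 < x)
    (h : s = 0 ∨ 1 ≤ x) :
    y * (2 * (1 / x ^ s) + x * (1 / (x + 1) ^ s)) ≤
      9 * 5 ^ s * (x * (x + 1) * (x + 2) / (x + 3) ^ (s + 1)) := by
  have h1 : 1 / x ^ s ≤ 5 ^ s / (x + 3) ^ s :=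
    inv_pow_le_of_le_five_mul hx (by positivity) (h.imp_right fun h => by linarith)
  have h2 : 1 / (x + 1) ^ s ≤ 5 ^ s / (x + 3) ^ s :=
    inv_pow_le_of_le_five_mul (by positivity) (by positivity) (Or.inr (by linarith))
  have h3 : x * (x + 2) ≤ 9 * (x * (x + 1) * (x + 2) / (x + 3)) := by
    rw [mul_div_assoc', le_div_iff₀ (by positivity)]
    nlinarith [mul_pos hx hx, mul_pos (mul_pos hx hx) hx]
  calc y * (2 * (1 / x ^ s) + x * (1 / (x + 1) ^ s))
      ≤ x * (2 * (5 ^ s / (x + 3) ^ s) + x * (5 ^ s / (x + 3) ^ s)) := by gcongr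
    _ = x * (x + 2) * (5 ^ s / (x + 3) ^ s) := by ring
    _ ≤ 9 * (x * (x + 1) * (x + 2) / (x + 3)) * (5 ^ s / (x + 3) ^ s) := by gcongr
    _ = _ := by
      rw [pow_succ]
      field_simp

theorem double_step_bound {s : ℕ} {x y : ℝ} (hy : 0 ≤ y) (hyx : y ≤ x) (hx : 0 < x)
    (h : s = 0 ∨ 1 ≤ x) :
    y ^ 2 * (1 / x ^ s) ≤
      9 * 5 ^ (s + 1) * (9 * 5 ^ s) *
        (x * (x + 1) * (x + 2) * (x + 3) / (x + 4) ^ (s + 2)) := by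
  have h1 : 1 / x ^ s ≤ 5 ^ s / (x + 4) ^ s :=
    inv_pow_le_of_le_five_mul hx (by positivity) (h.imp_right fun h => by linarith)
  have h3 : x ^ 2 ≤ 16 * (x * (x + 1) * (x + 2) * (x + 3) / (x + 4) ^ 2) := by
    rw [mul_div_assoc', le_div_iff₀ (by positivity)]
    nlinarith [mul_pos hx hx, mul_pos (mul_pos hx hx) hx, mul_pos (mul_pos hx hx) (mul_pos hx hx)]
  have hsq : y ^ 2 ≤ x ^ 2 := pow_le_pow_left₀ hy hyx 2
  have h5 : (1 : ℝ) ≤ 5 ^ s := one_le_pow₀ (by norm_num)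
  calc y ^ 2 * (1 / x ^ s)
      ≤ x ^ 2 * (5 ^ s / (x + 4) ^ s) := by gcongr
    _ ≤ 16 * (x * (x + 1) * (x + 2) * (x + 3) / (x + 4) ^ 2) * (5 ^ s / (x + 4) ^ s) := by gcongr
    _ = 16 * 5 ^ s * (x * (x + 1) * (x + 2) * (x + 3) / (x + 4) ^ (s + 2)) := by
      rw [pow_add]
      field_simp
    _ ≤ _ := by
      refine mul_le_mul_of_nonneg_right ?_ (by positivity)
      rw [pow_succ]
      nlinarith

theorem card_filter_le_succ (M : Finset ℕ) (n : ℕ) :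
    (M.filter (· ≤ n + 1)).card =
      (M.filter (· ≤ n)).card + if n + 1 ∈ M then 1 else 0 := by
  split_ifs with h
  · have : M.filter (· ≤ n + 1) = insert (n + 1) (M.filter (· ≤ n)) := by
      ext k
      simp only [mem_filter, mem_insert]
      constructor
      · rintro ⟨h1, h2⟩
        by_cases hk : k = n + 1
        · exact Or.inl hk
        · exact Or.inr ⟨h1, by omega⟩
      · rintro (rfl | h')
        · exact ⟨h, le_rfl⟩
        · exact ⟨h'.1, by omega⟩
    rw [this, card_insert_of_notMem (by simp)]
  · rw [add_zero]
    congr 1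
    refine filter_congr fun k hk => ?_
    have : k ≠ n + 1 := fun h' => h (h' ▸ hk)
    omega

theorem freeSum_le {α β : ℝ} (hα : 0 < α) (hβ : 0 < β) {M : Finset ℕ}
    (hM : ∀ m ∈ M, 3 ≤ m) (n : ℕ) {y : ℝ} (hy : 0 ≤ y) :
    freeSum α β M n (fun G => (β * y) ^ G.card) ≤
      freeSumConst (M.filter (· ≤ n)).card *
        ((α * β) ^ n * ∏ i ∈ range n, (y + 1 / α + i)) *
          (1 / (y + 1 / α + n) ^ (M.filter (· ≤ n)).card) := by
  induction n using Nat.strong_induction_on generalizing y with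
  | _ n ih =>
  have ha : 0 < 1 / α := by positivity
  have hpos : ∀ (k s t : ℕ), 0 ≤ freeSumConst s *
      ((α * β) ^ k * ∏ i ∈ range k, (y + 1 / α + (i : ℝ))) *
        (1 / (y + 1 / α + k) ^ t) := by
    intro k s t
    have := freeSumConst_pos s
    have : 0 ≤ ∏ i ∈ range k, (y + 1 / α + (i : ℝ)) :=
      prod_nonneg fun i _ => by positivity
    positivity
  have hshift : ∀ k : ℕ, (y + 1 / α) * ∏ i ∈ range k, (y + 1 + 1 / α + (i : ℝ)) =
      (∏ i ∈ range k, (y + 1 / α + (i : ℝ))) * (y + 1 / α + k) := by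
    intro k
    rw [← prod_range_succ, prod_range_succ', mul_comm]
    push_cast
    rw [add_zero]
    congr 1
    exact prod_congr rfl fun i _ => by ring
  have e : β * y + β = β * (y + 1) := by ring
  have e' : α * (β * y) + β = α * β * (y + 1 / α) := by
    field_simp
  have hsmall : ∀ k : ℕ, (M.filter (· ≤ k)).card = 0 ∨ 1 ≤ y + 1 / α + k := by
    intro k
    rcases Nat.eq_zero_or_pos k with rfl | hk
    · left
      rw [card_eq_zero]
      exact filter_false_of_mem fun m hm => by have := hM m hm; omega
    · right
      have : (1 : ℝ) ≤ k := by exact_mod_cast hk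
      linarith
  rcases n with _ | n
  · have h0 : M.filter (· ≤ 0) = ∅ :=
      filter_false_of_mem fun m hm => by have := hM m hm; omega
    rw [h0, card_empty, freeSum_zero]
    simp [freeSumConst]
  by_cases hn : n + 1 ∈ M
  · have hn3 := hM _ hn
    by_cases hn' : n ∈ M
    · obtain ⟨m, rfl⟩ : ∃ m, n = m + 3 := ⟨n - 3, by have := hM _ hn'; omega⟩
      rw [freeSum_add_four α β _ hM hn hn']
      by_cases h2 : m + 2 ∈ M
      · rw [if_pos h2]
        exact hpos _ _ _
      by_cases h1 : m + 1 ∈ M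
      · rw [if_neg h2, if_pos h1]
        exact hpos _ _ _
      rw [if_neg h2, if_neg h1]
      have hs : (M.filter (· ≤ m + 3 + 1)).card = (M.filter (· ≤ m)).card + 2 := by
        rw [card_filter_le_succ, card_filter_le_succ, card_filter_le_succ, card_filter_le_succ,
          if_neg h1, if_neg h2, if_pos hn', if_pos hn]
      rw [hs]
      have hb := ih m (by omega) hy
      have hsm := hsmall m
      generalize (M.filter (· ≤ m)).card = s at hb hsm
      have hx : 0 < y + 1 / α + m := by positivity
      have hQ : 0 ≤ ∏ i ∈ range m, (y + 1 / α + (i : ℝ)) :=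
        prod_nonneg fun i _ => by positivity
      have hstep := double_step_bound hy
        (by have : (0 : ℝ) ≤ m := Nat.cast_nonneg m
            linarith : y ≤ y + 1 / α + m) hx hsm
      have hC := freeSumConst_pos s
      simp only [prod_range_succ]
      push_cast
      simp only [freeSumConst]
      generalize ∏ i ∈ range m, (y + 1 / α + (i : ℝ)) = Q at hb hQ
      have c1 : y + 1 / α + ((m : ℝ) + 3 + 1) = y + 1 / α + m + 4 := by ring
      have c2 : y + 1 / α + ((m : ℝ) + 1) = y + 1 / α + m + 1 := by ring
      have c3 : y + 1 / α + ((m : ℝ) + 2) = y + 1 / α + m + 2 := by ring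
      have c4 : y + 1 / α + ((m : ℝ) + 3) = y + 1 / α + m + 3 := by ring
      rw [c1, c2, c3, c4]
      generalize y + 1 / α + (m : ℝ) = x at *
      calc _ ≤ α ^ 4 * β ^ 2 * (β * y) ^ 2 *
              (freeSumConst s * ((α * β) ^ m * Q) * (1 / x ^ s)) := by gcongr
        _ = freeSumConst s * (α * β) ^ (m + 4) * Q * (y ^ 2 * (1 / x ^ s)) := by ring
        _ ≤ freeSumConst s * (α * β) ^ (m + 4) * Q * _ :=
            mul_le_mul_of_nonneg_left hstep (by positivity)
        _ = _ := by ring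
    · obtain ⟨m, rfl⟩ : ∃ m, n = m + 2 := ⟨n - 2, by omega⟩
      rw [freeSum_add_three α β _ hM hn hn']
      by_cases h1 : m + 1 ∈ M
      · rw [if_pos h1]
        exact hpos _ _ _
      rw [if_neg h1]
      have hs : (M.filter (· ≤ m + 2 + 1)).card = (M.filter (· ≤ m)).card + 1 := by
        rw [card_filter_le_succ, card_filter_le_succ, card_filter_le_succ,
          if_neg h1, if_neg hn', if_pos hn]
      rw [hs, e, e']
      have hb := ih m (by omega) hy
      have hb' := ih m (by omega) (y := y + 1) (by positivity)
      have hsm := hsmall m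
      generalize (M.filter (· ≤ m)).card = s at hb hb' hsm
      have hx : 0 < y + 1 / α + m := by positivity
      have hQ : 0 ≤ ∏ i ∈ range m, (y + 1 / α + (i : ℝ)) :=
        prod_nonneg fun i _ => by positivity
      have hstep := single_step_bound
        (by have : (0 : ℝ) ≤ m := Nat.cast_nonneg m
            linarith : y ≤ y + 1 / α + m) hx hsm
      have hC := freeSumConst_pos s
      have hsh := hshift m
      simp only [prod_range_succ]
      push_cast
      simp only [freeSumConst]
      have hya : 0 ≤ y + 1 / α := by positivity
      generalize ∏ i ∈ range m, (y + 1 / α + (i : ℝ)) = Q at hb hQ hsh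
      generalize ∏ i ∈ range m, (y + 1 + 1 / α + (i : ℝ)) = Q' at hb' hsh
      have c1 : y + 1 / α + ((m : ℝ) + 2 + 1) = y + 1 / α + m + 3 := by ring
      have c2 : y + 1 / α + ((m : ℝ) + 1) = y + 1 / α + m + 1 := by ring
      have c3 : y + 1 / α + ((m : ℝ) + 2) = y + 1 / α + m + 2 := by ring
      have c4 : y + 1 + 1 / α + (m : ℝ) = y + 1 / α + m + 1 := by ring
      rw [c4] at hb'
      rw [c1, c2, c3]
      generalize y + 1 / α + (m : ℝ) = x at *
      calc _ ≤ α ^ 2 * β * (β * y) *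
              (2 * (α * β) * (freeSumConst s * ((α * β) ^ m * Q) * (1 / x ^ s)) +
                α * β * (y + 1 / α) *
                  (freeSumConst s * ((α * β) ^ m * Q') * (1 / (x + 1) ^ s))) := by gcongr
        _ = α ^ 2 * β * (β * y) * (α * β) ^ (m + 1) * freeSumConst s *
              (2 * Q * (1 / x ^ s) + ((y + 1 / α) * Q') * (1 / (x + 1) ^ s)) := by ring
        _ = freeSumConst s * (α * β) ^ (m + 3) * Q *
              (y * (2 * (1 / x ^ s) + x * (1 / (x + 1) ^ s))) := by
            rw [hsh]
            ring
        _ ≤ freeSumConst s * (α * β) ^ (m + 3) * Q * _ :=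
            mul_le_mul_of_nonneg_left hstep (by positivity)
        _ = _ := by ring
  · rw [freeSum_succ_pow_card α β _ hn, e, e', card_filter_le_succ, if_neg hn, add_zero]
    have hb := ih n (Nat.lt_succ_self n) (y := y + 1) (by positivity)
    have hya : 0 ≤ α * β * (y + 1 / α) := by positivity
    refine (mul_le_mul_of_nonneg_left hb hya).trans_eq ?_
    rw [prod_range_succ, ← hshift]
    push_cast
    have c : y + 1 + 1 / α + (n : ℝ) = y + 1 / α + ((n : ℝ) + 1) := by ring
    rw [c]
    ring

theorem finsum_stairWt_eq_freeSum (α β : ℝ) (M : Finset ℕ) (n : ℕ) (E : Set (ℕ → ℕ → StairSymb))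
    (hE : ∀ S, S ∈ E ↔ S ∈ thirdDiagTableaux M n) :
    ∑ᶠ S ∈ E, stairWt α β S = freeSum α β M n (fun G => 1 ^ G.card) := by
  have : E = ↑(thirdDiagTableaux M n) := by
    ext S
    rw [hE, mem_coe]
  rw [this, finsum_mem_coe_finset, freeSum]
  simp

end Bounds

/-- If some two consecutive chosen columns on the third main diagonal are at distance
at most `2`, the probability that all chosen boxes contain α is `O(1/(n+a+b)^r)`
uniformly. -/
theorem alphas_on_third_diagonal_close_columns (r : ℕ) (hr : 2 ≤ r) :
    ∃ C : ℝ, 0 < C ∧ ∀ n : ℕ, 3 ≤ n → ∀ α β : ℝ, 0 < α → 0 < β →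
      ∀ j : Fin r → ℕ, (∀ l, 1 ≤ j l) → (∀ l, j l ≤ n - 2) → StrictMono j →
      (∃ l : Fin r, ∃ h : (l : ℕ) + 1 < r, j ⟨(l : ℕ) + 1, h⟩ ≤ j l + 2) →
      stairP n α β (fun S => ∀ l : Fin r, S (n - j l - 1) (j l) = StairSymb.alpha)
        ≤ C / ((n : ℝ) + 1/α + 1/β) ^ r := by
  classical
  refine ⟨freeSumConst r, freeSumConst_pos r, fun n hn α β hα hβ j hj1 hj2 hj _ => ?_⟩
  set M : Finset ℕ := Finset.univ.image (fun l => n + 1 - j l) with hMdef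
  have hM : ∀ m ∈ M, 3 ≤ m := by
    intro m hm
    obtain ⟨l, -, rfl⟩ := Finset.mem_image.1 hm
    have := hj2 l
    omega
  have hcard : (M.filter (· ≤ n)).card = r := by
    rw [Finset.filter_true_of_mem, hMdef, Finset.card_image_of_injective, Finset.card_fin]
    · intro l l' h
      have h1 := hj2 l
      have h2 := hj2 l'
      exact hj.injective (by simp only at h; omega)
    · intro m hm
      obtain ⟨l, -, rfl⟩ := Finset.mem_image.1 hm
      have := hj1 l
      omega
  have hnum : ∑ᶠ S ∈ {S : ℕ → ℕ → StairSymb | IsStaircase n S ∧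
      ∀ l : Fin r, S (n - j l - 1) (j l) = StairSymb.alpha}, stairWt α β S =
        freeSum α β M n (fun G => (β * (1 / β)) ^ G.card) := by
    rw [mul_one_div_cancel hβ.ne']
    refine finsum_stairWt_eq_freeSum α β M n _ fun S => ?_
    rw [mem_thirdDiagTableaux, Set.mem_ofPred_eq]
    refine and_congr_right fun _ => ⟨fun h m hm _ _ => ?_, fun h l => ?_⟩
    · obtain ⟨l, -, rfl⟩ := Finset.mem_image.1 hm
      have h1 := hj1 l
      have h2 := hj2 l
      have e1 : n + 1 - j l - 2 = n - j l - 1 := by omega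
      have e2 : n + 1 - (n + 1 - j l) = j l := by omega
      rw [e1, e2]
      exact h l
    · have h1 := hj1 l
      have h2 := hj2 l
      have := h (n + 1 - j l) (Finset.mem_image_of_mem _ (Finset.mem_univ l)) (by omega) (by omega)
      have e1 : n + 1 - j l - 2 = n - j l - 1 := by omega
      have e2 : n + 1 - (n + 1 - j l) = j l := by omega
      rwa [e1, e2] at this
  have hden : stairZ n α β = (α * β) ^ n * ∏ i ∈ Finset.range n, (1 / β + 1 / α + (i : ℝ)) := by
    rw [← freeSum_empty_pow_card hα, mul_one_div_cancel hβ.ne', stairZ]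
    refine finsum_stairWt_eq_freeSum α β ∅ n _ fun S => ?_
    rw [mem_thirdDiagTableaux, Set.mem_ofPred_eq]
    simp
  have hZ : 0 < stairZ n α β := by
    rw [hden]
    have : 0 < ∏ i ∈ Finset.range n, (1 / β + 1 / α + (i : ℝ)) :=
      Finset.prod_pos fun i _ => by positivity
    positivity
  have hb := freeSum_le hα hβ hM n (y := 1 / β) (by positivity)
  rw [hcard, ← hden] at hb
  rw [stairP, hnum, div_le_iff₀ hZ]
  refine hb.trans_eq ?_
  have e : 1 / β + 1 / α + (n : ℝ) = n + 1 / α + 1 / β := by ring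
  rw [e]
  ring
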